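/- arXiv:1904.00588 — 3 statements merged into one kernel-verified Lean document; each statement's English description precedes it below -/
import Mathlib

section
/- Let V be a nonempty bounded convex subset of ℂ, and suppose closedBall(c, r) is a minimal-radius closed disk containing V, i.e. V ⊆ closedBall(c, r) and for every c' ∈ ℂ and r' ≥ 0 with V ⊆ closedBall(c', r') one has r ≤ r'. Then the center c lies in the (real) convex hull of sphere(c, r) ∩ closure(V). -/
/-- In a finite-dimensional normed space, the convex hull of a compact set is compact. -/
theorem IsCompact.convexHull_of_finiteDimensional {E : Type*} [NormedAddCommGroup E]
    [NormedSpace ℝ E] [FiniteDimensional ℝ E] {s : Set E} (hs : IsCompact s) :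
    IsCompact (convexHull ℝ s) := by
  have key : convexHull ℝ s = ⋃ k ∈ Finset.range (Module.finrank ℝ E + 2),
      (fun p : (Fin k → ℝ) × (Fin k → E) => ∑ i, p.1 i • p.2 i) ''
        (stdSimplex ℝ (Fin k) ×ˢ Set.univ.pi fun _ => s) := by
    apply Set.Subset.antisymm
    · intro x hx
      obtain ⟨ι, _, z, w, hz, hind, hw, hw1, rfl⟩ := eq_pos_convex_span_of_mem_convexHull hx
      have hcard : Fintype.card ι ≤ Module.finrank ℝ E + 1 :=
        hind.card_le_finrank_succ.trans (Nat.succ_le_succ (Submodule.finrank_le _))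
      let e := Fintype.equivFin ι
      simp only [Set.mem_iUnion]
      refine ⟨Fintype.card ι, Finset.mem_range.2 (by omega), (w ∘ e.symm, z ∘ e.symm),
        ⟨⟨fun i => (hw _).le, ?_⟩, fun i _ => hz (Set.mem_range_self _)⟩, ?_⟩
      · exact (Equiv.sum_comp e.symm w).trans hw1
      · exact Equiv.sum_comp e.symm fun i => w i • z i
    · simp only [Set.iUnion_subset_iff]
      rintro k - _ ⟨⟨w, z⟩, ⟨⟨hw, hw1⟩, hz⟩, rfl⟩
      exact (convex_convexHull ℝ s).sum_mem (fun i _ => hw i) hw1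
        fun i _ => subset_convexHull ℝ s (hz i trivial)
  rw [key]
  refine Finset.isCompact_biUnion _ fun k _ => ?_
  exact ((isCompact_stdSimplex ℝ (Fin k)).prod (isCompact_univ_pi fun _ => hs)).image
    (by fun_prop)

/-- If a compact set `K` lies in a closed ball and its contact points with the boundary sphere lie
strictly on one side of a hyperplane through the center, then some ball of the same radius contains
`K` in its interior. -/
theorem IsCompact.exists_forall_dist_lt_of_inner_pos {E : Type*} [NormedAddCommGroup E]
    [InnerProductSpace ℝ E] {K : Set E} (hK : IsCompact K) {c d : E} {r δ : ℝ} (hδ : 0 < δ)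
    (hKr : K ⊆ Metric.closedBall c r)
    (hd : ∀ z ∈ Metric.sphere c r ∩ K, δ < inner ℝ d (z - c)) :
    ∃ c' : E, ∀ z ∈ K, dist z c' < r := by
  have hA : IsCompact (K ∩ {z | inner ℝ d (z - c) ≤ δ}) :=
    hK.inter_right (isClosed_le (by fun_prop) continuous_const)
  obtain ⟨η, hη, hηA⟩ := hA.exists_forall_le' (f := fun z => r - dist z c) (a := 0)
    (by fun_prop) (fun z hz => by
      refine sub_pos.2 (lt_of_le_of_ne (hKr hz.1) fun h => ?_)
      exact (hd z ⟨h, hz.1⟩).not_ge hz.2)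
  obtain ⟨ε, hε, hε1, hε2⟩ : ∃ ε : ℝ, 0 < ε ∧ ε * ‖d‖ < η ∧ ε * ‖d‖ ^ 2 < δ := by
    have h1 : ∀ᶠ ε : ℝ in nhdsWithin 0 (Set.Ioi 0), ε * ‖d‖ < η :=
      nhdsWithin_le_nhds <| (continuous_id.mul continuous_const).continuousAt.eventually_lt
        continuousAt_const (by simpa using hη)
    have h2 : ∀ᶠ ε : ℝ in nhdsWithin 0 (Set.Ioi 0), ε * ‖d‖ ^ 2 < δ :=
      nhdsWithin_le_nhds <| (continuous_id.mul continuous_const).continuousAt.eventually_lt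
        continuousAt_const (by simpa using hδ)
    exact ((eventually_mem_nhdsWithin.and (h1.and h2)).exists)
  refine ⟨c + ε • d, fun z hz => ?_⟩
  have hzr : ‖z - c‖ ≤ r := by simpa [dist_eq_norm] using hKr hz
  have hr : 0 ≤ r := (norm_nonneg _).trans hzr
  have heq : z - (c + ε • d) = z - c - ε • d := by abel
  rw [dist_eq_norm, heq]
  by_cases h : inner ℝ d (z - c) ≤ δ
  · have h1 : η ≤ r - ‖z - c‖ := by simpa [dist_eq_norm] using hηA z ⟨hz, h⟩
    have h2 := norm_sub_le (z - c) (ε • d)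
    rw [norm_smul, Real.norm_of_nonneg hε.le] at h2
    linarith
  · push Not at h
    refine lt_of_pow_lt_pow_left₀ 2 hr ?_
    rw [norm_sub_sq_real, norm_smul, Real.norm_of_nonneg hε.le, inner_smul_right,
      real_inner_comm]
    have h1 : ‖z - c‖ ^ 2 ≤ r ^ 2 := by gcongr
    have h2 := mul_lt_mul_of_pos_left h hε
    have h3 := mul_lt_mul_of_pos_left hε2 hε
    have h4 := mul_pos hε hδ
    nlinarith

/-- The center of the minimal-radius closed disk containing a nonempty bounded convex
subset `V` of `ℂ` lies in the real convex hull of the contact set of `closure V`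
with the boundary circle. -/
theorem center_mem_convexHull_contact (V : Set ℂ) (hne : V.Nonempty)
    (hbd : Bornology.IsBounded V) (hconv : Convex ℝ V) (c : ℂ) (r : ℝ)
    (hV : V ⊆ Metric.closedBall c r)
    (hmin : ∀ (c' : ℂ) (r' : ℝ), 0 ≤ r' → V ⊆ Metric.closedBall c' r' → r ≤ r') :
    c ∈ convexHull ℝ (Metric.sphere c r ∩ closure V) := by
  by_contra hc
  have hK : IsCompact (closure V) := hbd.isCompact_closure
  have hKr : closure V ⊆ Metric.closedBall c r := closure_minimal hV Metric.isClosed_closedBall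
  have hcl : IsClosed (convexHull ℝ (Metric.sphere c r ∩ closure V)) :=
    (hK.inter_left Metric.isClosed_sphere).convexHull_of_finiteDimensional.isClosed
  obtain ⟨f, u, hfc, hfu⟩ :=
    geometric_hahn_banach_point_closed (convex_convexHull ℝ _) hcl hc
  obtain ⟨c', hc'⟩ := hK.exists_forall_dist_lt_of_inner_pos
    (d := (InnerProductSpace.toDual ℝ ℂ).symm f) (sub_pos.2 hfc) hKr (fun z hz => by
      rw [InnerProductSpace.toDual_symm_apply, map_sub]
      exact sub_lt_sub_right (hfu z (subset_convexHull ℝ _ hz)) _)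
  obtain ⟨z, hz, hmax⟩ := hK.exists_isMaxOn hne.closure
    (f := fun z => dist z c') (by fun_prop)
  exact (hc' z hz).not_ge <| hmin c' _ dist_nonneg fun w hw => hmax (subset_closure hw)
end

section
/- Let K be a nonempty compact convex subset of ℂ, and regard ℂ as embedded in its one-point compactification OnePoint ℂ (the Riemann sphere ℂ ∪ {∞}). Then the complement U = (OnePoint ℂ) \ K, equipped with the subspace topology, is a connected and simply connected topological space. -/
open Filter Topology

/-- The chart `z ↦ (z - c)⁻¹` of the Riemann sphere, sending `∞` to `0`. -/
noncomputable def invSubChart (c : ℂ) (p : OnePoint ℂ) : ℂ :=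
  p.elim 0 fun z ↦ (z - c)⁻¹

open Classical in
/-- The parametrization `w ↦ c + w⁻¹` of the Riemann sphere minus `c`, sending `0` to `∞`. -/
noncomputable def addInvParam (c w : ℂ) : OnePoint ℂ :=
  if w = 0 then OnePoint.infty else ((c + w⁻¹ : ℂ) : OnePoint ℂ)

@[simp]
theorem addInvParam_zero (c : ℂ) : addInvParam c 0 = OnePoint.infty := if_pos rfl

theorem addInvParam_of_ne_zero (c : ℂ) {w : ℂ} (hw : w ≠ 0) :
    addInvParam c w = ((c + w⁻¹ : ℂ) : OnePoint ℂ) := if_neg hw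

theorem invSubChart_addInvParam (c w : ℂ) : invSubChart c (addInvParam c w) = w := by
  by_cases hw : w = 0
  · simp [hw, invSubChart]
  · simp [addInvParam_of_ne_zero c hw, invSubChart]

theorem addInvParam_invSubChart (c : ℂ) {p : OnePoint ℂ} (hp : p ≠ (c : OnePoint ℂ)) :
    addInvParam c (invSubChart c p) = p := by
  induction p using OnePoint.rec with
  | infty => simp [invSubChart]
  | coe z =>
    have hz : (z - c)⁻¹ ≠ 0 := inv_ne_zero (sub_ne_zero.2 fun h ↦ hp (by rw [h]))
    simp [invSubChart, addInvParam_of_ne_zero c hz]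

theorem continuousAt_invSubChart (c : ℂ) {p : OnePoint ℂ} (hp : p ≠ (c : OnePoint ℂ)) :
    ContinuousAt (invSubChart c) p := by
  induction p using OnePoint.rec with
  | infty =>
    rw [OnePoint.continuousAt_infty', coclosedCompact_eq_cocompact,
      ← Metric.cobounded_eq_cocompact]
    exact tendsto_inv₀_cobounded.comp (tendsto_sub_const_cobounded c)
  | coe z =>
    rw [OnePoint.continuousAt_coe]
    have hz : z - c ≠ 0 := sub_ne_zero.2 fun h ↦ hp (by rw [h])
    exact (continuousAt_id.sub continuousAt_const).inv₀ hz

theorem continuous_addInvParam (c : ℂ) : Continuous (addInvParam c) := by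
  rw [continuous_iff_continuousAt]
  intro w
  by_cases hw : w = 0
  · subst hw
    rw [← continuousWithinAt_compl_self, ContinuousWithinAt, addInvParam_zero]
    have h : Tendsto (fun w : ℂ ↦ c + w⁻¹) (𝓝[≠] 0) (coclosedCompact ℂ) := by
      rw [coclosedCompact_eq_cocompact, ← Metric.cobounded_eq_cocompact]
      exact (tendsto_const_add_cobounded c).comp tendsto_inv₀_nhdsNE_zero
    exact (OnePoint.tendsto_coe_infty.comp h).congr' <|
      eventually_mem_nhdsWithin.mono fun w hw ↦ (addInvParam_of_ne_zero c hw).symm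
  · have h : ContinuousAt (fun w : ℂ ↦ ((c + w⁻¹ : ℂ) : OnePoint ℂ)) w :=
      OnePoint.continuous_coe.continuousAt.comp
        (continuousAt_const.add (continuousAt_inv₀ hw))
    exact h.congr <| (isOpen_ne.eventually_mem hw).mono fun w hw ↦ (addInvParam_of_ne_zero c hw).symm

/-- A subset of the Riemann sphere that omits `c` is homeomorphic to its image under the chart
`z ↦ (z - c)⁻¹`. -/
noncomputable def homeomorphPreimageAddInvParam (c : ℂ) (U : Set (OnePoint ℂ))
    (hc : (c : OnePoint ℂ) ∉ U) : U ≃ₜ (addInvParam c ⁻¹' U) where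
  toFun p := ⟨invSubChart c p, by
    rw [Set.mem_preimage, addInvParam_invSubChart c (ne_of_mem_of_not_mem p.2 hc)]
    exact p.2⟩
  invFun w := ⟨addInvParam c w, w.2⟩
  left_inv p := Subtype.ext (addInvParam_invSubChart c (ne_of_mem_of_not_mem p.2 hc))
  right_inv w := Subtype.ext (invSubChart_addInvParam c w)
  continuous_toFun := by
    refine Continuous.subtype_mk (continuous_iff_continuousAt.2 fun p ↦ ?_) _
    exact (continuousAt_invSubChart c (ne_of_mem_of_not_mem p.2 hc)).comp
      continuousAt_subtype_val
  continuous_invFun := ((continuous_addInvParam c).comp continuous_subtype_val).subtype_mk _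

theorem StarConvex.preimage_addInvParam_compl {K : Set ℂ} {c : ℂ} (hK : StarConvex ℝ c K) :
    StarConvex ℝ 0 (addInvParam c ⁻¹' (((↑) : ℂ → OnePoint ℂ) '' K)ᶜ) := by
  rw [starConvex_zero_iff]
  intro w hw t ht₀ ht₁
  by_cases htw : t • w = 0
  · simp [htw]
  have ht : t ≠ 0 := left_ne_zero_of_smul htw
  have hw₀ : w ≠ 0 := right_ne_zero_of_smul htw
  rw [Set.mem_preimage, addInvParam_of_ne_zero c htw]
  rw [Set.mem_preimage, addInvParam_of_ne_zero c hw₀] at hw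
  rintro ⟨z, hz, hzw⟩
  rw [OnePoint.coe_eq_coe] at hzw
  subst hzw
  refine hw ⟨_, hK.add_smul_mem hz ht₀ ht₁, ?_⟩
  simp only [smul_inv₀, smul_smul, mul_inv_cancel₀ ht, one_smul]

/-- The complement in the Riemann sphere of a nonempty star-convex subset of `ℂ` is
contractible. -/
theorem StarConvex.contractibleSpace_compl_coe_image {K : Set ℂ} {c : ℂ}
    (hK : StarConvex ℝ c K) (hc : c ∈ K) :
    ContractibleSpace ↥((((↑) : ℂ → OnePoint ℂ) '' K)ᶜ) := by
  have : ContractibleSpace ↥(addInvParam c ⁻¹' (((↑) : ℂ → OnePoint ℂ) '' K)ᶜ) :=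
    hK.preimage_addInvParam_compl.contractibleSpace ⟨0, by simp⟩
  exact (homeomorphPreimageAddInvParam c _ (not_not_intro ⟨c, hc, rfl⟩)).contractibleSpace

/-- The complement in the Riemann sphere `ℂ ∪ {∞}` of a nonempty compact convex subset
of `ℂ` is connected and simply connected. -/
theorem complement_compact_convex_connected_simplyConnected (K : Set ℂ)
    (hne : K.Nonempty) (hcpt : IsCompact K) (hconv : Convex ℝ K) :
    ConnectedSpace ↥((((↑) : ℂ → OnePoint ℂ) '' K)ᶜ) ∧
    SimplyConnectedSpace ↥((((↑) : ℂ → OnePoint ℂ) '' K)ᶜ) := by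
  obtain ⟨c, hc⟩ := hne
  have := (hconv.starConvex hc).contractibleSpace_compl_coe_image hc
  exact ⟨inferInstance, inferInstance⟩
end

section
/- Let K be a nonempty compact convex subset of ℂ, and regard ℂ as embedded in its one-point compactification OnePoint ℂ (the Riemann sphere ℂ ∪ {∞}). Then the complement U = (OnePoint ℂ) \ K, equipped with the subspace topology, is homeomorphic to the open unit disk ball(0, 1) in ℂ. -/
open Set Filter Topology Metric

lemma tendsto_infDist_cobounded {E : Type*} [PseudoMetricSpace E] {K : Set E}
    (hcpt : IsCompact K) {p : E} (hp : p ∈ K) :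
    Tendsto (fun x ↦ infDist x K) (Bornology.cobounded E) atTop := by
  refine tendsto_atTop_mono (f := fun x ↦ dist x p + -diam K) (fun x ↦ ?_)
    (tendsto_atTop_add_const_right _ _ (tendsto_dist_right_cobounded_atTop p))
  linarith [dist_le_infDist_add_diam (x := x) hcpt.isBounded hp]

section ConvexComplement

variable {E : Type*} [NormedAddCommGroup E] [NormedSpace ℝ E]

/-- The distance to a convex set shrinks at least linearly under contraction towards
a point of the set. -/
lemma infDist_add_smul_sub_le {K : Set E} {p : E} (hK : Convex ℝ K) (hcpt : IsCompact K)
    (hp : p ∈ K) (x : E) {t : ℝ} (ht0 : 0 ≤ t) (ht1 : t ≤ 1) :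
    infDist (p + t • (x - p)) K ≤ t * infDist x K := by
  obtain ⟨y, hy, hxy⟩ := hcpt.exists_infDist_eq_dist ⟨p, hp⟩ x
  refine (infDist_le_dist_of_mem (hK.add_smul_sub_mem hp hy ⟨ht0, ht1⟩)).trans_eq ?_
  rw [hxy, dist_add_left, dist_smul₀, dist_sub_right, Real.norm_of_nonneg ht0]

/-- The radial map with centre `p` taking a point at distance `d` from `K` to a point of
norm `1 / (1 + d)`. -/
noncomputable def radialInversion (K : Set E) (p x : E) : E :=
  (1 + infDist x K)⁻¹ • ‖x - p‖⁻¹ • (x - p)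

lemma norm_radialInversion (K : Set E) {p x : E} (hx : x ≠ p) :
    ‖radialInversion K p x‖ = (1 + infDist x K)⁻¹ := by
  have h : ‖x - p‖ ≠ 0 := norm_ne_zero_iff.2 (sub_ne_zero.2 hx)
  have hd : 0 ≤ infDist x K := infDist_nonneg
  rw [radialInversion, norm_smul, norm_smul, norm_inv ‖x - p‖, norm_norm, inv_mul_cancel₀ h,
    mul_one, Real.norm_of_nonneg (by positivity)]

lemma continuousAt_radialInversion (K : Set E) {p x : E} (hx : x ≠ p) :
    ContinuousAt (radialInversion K p) x := by
  have h : ‖x - p‖ ≠ 0 := norm_ne_zero_iff.2 (sub_ne_zero.2 hx)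
  have hd : 1 + infDist x K ≠ 0 := by
    have : 0 ≤ infDist x K := infDist_nonneg
    positivity
  have hc : ContinuousAt (fun y : E ↦ y - p) x := by fun_prop
  exact ((continuousAt_const.add (continuous_infDist_pt K).continuousAt).inv₀ hd).smul
    ((hc.norm.inv₀ h).smul hc)

lemma tendsto_radialInversion_cobounded {K : Set E} (hcpt : IsCompact K) {p : E} (hp : p ∈ K) :
    Tendsto (radialInversion K p) (Bornology.cobounded E) (𝓝 0) := by
  rw [tendsto_zero_iff_norm_tendsto_zero]
  have h := tendsto_inv_atTop_zero.comp
    (tendsto_atTop_add_const_left _ (1 : ℝ) (tendsto_infDist_cobounded hcpt hp))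
  refine h.congr' ?_
  filter_upwards [Bornology.isBounded_singleton (x := p)] with x hx
  exact (norm_radialInversion K hx).symm

lemma radialInversion_injOn {K : Set E} (hK : Convex ℝ K) (hcpt : IsCompact K) {p : E}
    (hp : p ∈ K) : InjOn (radialInversion K p) Kᶜ := by
  have hpos : ∀ z ∈ Kᶜ, 0 < infDist z K := fun z hz ↦
    (hcpt.isClosed.notMem_iff_infDist_pos ⟨p, hp⟩).1 hz
  have hne : ∀ z ∈ Kᶜ, z ≠ p := fun z hz h ↦ hz (h ▸ hp)
  -- on a common ray, the point nearer to `p` is strictly nearer to `K`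
  have hle : ∀ x ∈ Kᶜ, ∀ y ∈ Kᶜ, infDist x K = infDist y K →
      ‖x - p‖⁻¹ • (x - p) = ‖y - p‖⁻¹ • (y - p) → ‖x - p‖ ≤ ‖y - p‖ := by
    intro x hx y hy hd he
    by_contra! hlt
    have hnx : 0 < ‖x - p‖ := (norm_nonneg _).trans_lt hlt
    have hny : ‖y - p‖ ≠ 0 := norm_ne_zero_iff.2 (sub_ne_zero.2 (hne y hy))
    have hyx : y = p + (‖y - p‖ / ‖x - p‖) • (x - p) := by
      rw [div_eq_mul_inv, mul_smul, he, smul_inv_smul₀ hny, add_sub_cancel]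
    have ht : ‖y - p‖ / ‖x - p‖ < 1 := (div_lt_one hnx).2 hlt
    have h := infDist_add_smul_sub_le hK hcpt hp x (by positivity) ht.le
    rw [← hyx, ← hd] at h
    nlinarith [hpos x hx]
  intro x hx y hy hxy
  have hd : infDist x K = infDist y K := by
    have h := congrArg norm hxy
    rw [norm_radialInversion K (hne x hx), norm_radialInversion K (hne y hy)] at h
    exact add_left_cancel (inv_injective h)
  have hd0 : (1 + infDist y K)⁻¹ ≠ 0 := by
    have := hpos y hy
    positivity
  have he : ‖x - p‖⁻¹ • (x - p) = ‖y - p‖⁻¹ • (y - p) := by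
    rw [radialInversion, radialInversion, hd] at hxy
    exact smul_right_injective E hd0 hxy
  have hn := (hle x hx y hy hd he).antisymm (hle y hy x hx hd.symm he.symm)
  rw [hn] at he
  have hny : ‖y - p‖⁻¹ ≠ 0 := inv_ne_zero (norm_ne_zero_iff.2 (sub_ne_zero.2 (hne y hy)))
  exact sub_left_injective (smul_right_injective E hny he)

lemma exists_radialInversion_eq {K : Set E} (hcpt : IsCompact K) {p : E} (hp : p ∈ K) {w : E}
    (hw0 : w ≠ 0) (hw1 : ‖w‖ < 1) : ∃ x ∈ Kᶜ, radialInversion K p x = w := by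
  have hw : 0 < ‖w‖ := norm_pos_iff.2 hw0
  have hδ : 0 < ‖w‖⁻¹ - 1 := sub_pos.2 ((one_lt_inv₀ hw).2 hw1)
  have hfar : Tendsto (fun t : ℝ ↦ infDist (p + t • w) K) atTop atTop := by
    refine (tendsto_infDist_cobounded hcpt hp).comp ?_
    rw [← tendsto_norm_atTop_iff_cobounded]
    refine tendsto_atTop_mono' _ (f₁ := fun t : ℝ ↦ t * ‖w‖ + -‖p‖) ?_
      (tendsto_atTop_add_const_right _ _ (tendsto_id.atTop_mul_const hw))
    filter_upwards [eventually_ge_atTop 0] with t ht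
    have h := norm_sub_le (p + t • w) p
    rw [add_sub_cancel_left, norm_smul, Real.norm_of_nonneg ht] at h
    linarith
  obtain ⟨T, hT, hT0⟩ := ((hfar.eventually_ge_atTop (‖w‖⁻¹ - 1)).and (eventually_ge_atTop 0)).exists
  have hcont : Continuous fun t : ℝ ↦ infDist (p + t • w) K :=
    (continuous_infDist_pt K).comp (by fun_prop)
  obtain ⟨t, ⟨ht0, -⟩, ht⟩ := intermediate_value_Icc hT0 hcont.continuousOn
    (show ‖w‖⁻¹ - 1 ∈ Icc _ _ from ⟨by simpa [infDist_zero_of_mem hp] using hδ.le, hT⟩)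
  have hmem : p + t • w ∉ K := (hcpt.isClosed.notMem_iff_infDist_pos ⟨p, hp⟩).2 (by
    simpa only [ht] using hδ)
  have htpos : 0 < t := ht0.lt_of_ne (by rintro rfl; simp [hp] at hmem)
  refine ⟨_, hmem, ?_⟩
  simp only at ht
  rw [radialInversion, ht, add_sub_cancel_left, norm_smul, Real.norm_of_nonneg ht0, smul_smul,
    smul_smul, add_sub_cancel, inv_inv]
  convert one_smul ℝ w using 2
  field_simp

/-- In the one-point compactification of a finite-dimensional normed space, the complement of a
nonempty compact convex set is homeomorphic to the open unit ball. -/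
theorem nonempty_homeomorph_compl_image_coe_ball [ProperSpace E] {K : Set E} (hne : K.Nonempty)
    (hcpt : IsCompact K) (hK : Convex ℝ K) :
    Nonempty (↥((((↑) : E → OnePoint E) '' K)ᶜ) ≃ₜ ↥(ball (0 : E) 1)) := by
  obtain ⟨p, hp⟩ := hne
  set U : Set (OnePoint E) := (((↑) : E → OnePoint E) '' K)ᶜ with hU
  let g : OnePoint E → E := fun z ↦ z.elim 0 (radialInversion K p)
  have hcoe : ∀ x : E, (x : OnePoint E) ∈ U ↔ x ∉ K := fun x ↦ by
    rw [hU, mem_compl_iff, OnePoint.coe_injective.mem_set_image]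
  have hnep : ∀ x : E, x ∉ K → x ≠ p := fun x hx h ↦ hx (h ▸ hp)
  have hpos : ∀ x : E, x ∉ K → 0 < infDist x K := fun x hx ↦
    (hcpt.isClosed.notMem_iff_infDist_pos ⟨p, hp⟩).1 hx
  have hnorm : ∀ x : E, x ∉ K → ‖g x‖ = (1 + infDist x K)⁻¹ := fun x hx ↦
    norm_radialInversion K (hnep x hx)
  have hg0 : ∀ x : E, x ∉ K → g x ≠ 0 := fun x hx ↦ by
    rw [← norm_ne_zero_iff, hnorm x hx]
    have := hpos x hx
    positivity
  have hball : ∀ z : U, g z ∈ ball (0 : E) 1 := by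
    rintro ⟨z, hz⟩
    rw [mem_ball_zero_iff]
    induction z using OnePoint.rec with
    | infty => simp [g]
    | coe x =>
      rw [hcoe] at hz
      rw [hnorm x hz]
      exact inv_lt_one_of_one_lt₀ (by linarith [hpos x hz])
  have hcont : Continuous fun z : U ↦ g z := by
    rw [continuous_iff_continuousAt]
    rintro ⟨z, hz⟩
    refine ContinuousAt.comp (g := g) (f := Subtype.val) ?_ continuousAt_subtype_val
    change ContinuousAt g z
    induction z using OnePoint.rec with
    | infty =>
      rw [OnePoint.continuousAt_infty', coclosedCompact_eq_cocompact,
        ← cobounded_eq_cocompact]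
      exact tendsto_radialInversion_cobounded hcpt hp
    | coe x =>
      rw [OnePoint.continuousAt_coe]
      exact continuousAt_radialInversion K (hnep x ((hcoe x).1 hz))
  let G : U → ball (0 : E) 1 := fun z ↦ ⟨g z, hball z⟩
  have hG : Continuous G := hcont.subtype_mk _
  have hinj : Function.Injective G := by
    rintro ⟨z, hz⟩ ⟨w, hw⟩ h
    replace h : g z = g w := congrArg Subtype.val h
    refine Subtype.ext ?_
    change z = w
    induction z using OnePoint.rec with
    | infty =>
      induction w using OnePoint.rec with
      | infty => rfl
      | coe y => exact absurd h.symm (hg0 y ((hcoe y).1 hw))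
    | coe x =>
      induction w using OnePoint.rec with
      | infty => exact absurd h (hg0 x ((hcoe x).1 hz))
      | coe y =>
        exact congrArg _ (radialInversion_injOn hK hcpt hp ((hcoe x).1 hz) ((hcoe y).1 hw) h)
  have hsurj : Function.Surjective G := by
    rintro ⟨w, hw⟩
    by_cases hw0 : w = 0
    · exact ⟨⟨OnePoint.infty, OnePoint.infty_notMem_image_coe⟩, Subtype.ext hw0.symm⟩
    · obtain ⟨x, hx, hxw⟩ := exists_radialInversion_eq hcpt hp hw0 (mem_ball_zero_iff.1 hw)
      exact ⟨⟨x, (hcoe x).2 hx⟩, Subtype.ext hxw⟩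
  have : LocallyCompactSpace (ball (0 : E) 1) := isOpen_ball.locallyCompactSpace
  have hproper : IsProperMap G := by
    refine isProperMap_iff_isCompact_preimage.2 ⟨hG, fun S hS ↦ ?_⟩
    rcases S.eq_empty_or_nonempty with rfl | hSne
    · simp
    obtain ⟨m, -, hm⟩ := hS.exists_isMaxOn hSne
      (f := fun w : ball (0 : E) 1 ↦ ‖(w : E)‖) (by fun_prop)
    have hm1 : ‖(m : E)‖ < 1 := mem_ball_zero_iff.1 m.2
    -- points of `U` whose image lies in `S` stay away from `K`
    obtain ⟨δ, hδ, hmδ⟩ : ∃ δ : ℝ, 0 < δ ∧ ‖(m : E)‖ < (1 + δ)⁻¹ := by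
      obtain ⟨s, hs, hs1⟩ := exists_between hm1
      have hs0 : 0 < s := (norm_nonneg _).trans_lt hs
      exact ⟨s⁻¹ - 1, sub_pos.2 ((one_lt_inv₀ hs0).2 hs1), by simpa using hs⟩
    have hopen : IsOpen {x : E | infDist x K < δ} :=
      isOpen_lt (continuous_infDist_pt K) continuous_const
    let C : Set (OnePoint E) := (((↑) : E → OnePoint E) '' {x : E | infDist x K < δ})ᶜ
    have hC : IsCompact C := (OnePoint.isOpen_image_coe.2 hopen).isClosed_compl.isCompact
    have hCU : C ⊆ U := compl_subset_compl.2 (image_mono fun x hx ↦ by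
      simpa [infDist_zero_of_mem hx] using hδ)
    have hCcompact : IsCompact ((↑) ⁻¹' C : Set U) := by
      rw [Subtype.isCompact_iff, Subtype.image_preimage_coe, inter_eq_right.2 hCU]
      exact hC
    refine hCcompact.of_isClosed_subset (hS.isClosed.preimage hG) ?_
    rintro ⟨z, hz⟩ hzS ⟨x, hx, rfl⟩
    have h1 : ‖g x‖ ≤ ‖(m : E)‖ := hm hzS
    have hxK := (hcoe x).1 hz
    rw [hnorm x hxK] at h1
    have h2 : (1 + δ)⁻¹ < (1 + infDist x K)⁻¹ :=
      inv_strictAnti₀ (by linarith [hpos x hxK]) (by linarith [show infDist x K < δ from hx])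
    linarith
  exact ⟨(isHomeomorph_iff_continuous_isClosedMap_bijective.2
    ⟨hG, hproper.isClosedMap, hinj, hsurj⟩).homeomorph G⟩

end ConvexComplement


/-- The complement in the Riemann sphere `ℂ ∪ {∞}` of a nonempty compact convex subset
of `ℂ` is homeomorphic to the open unit disk. -/
theorem complement_compact_convex_homeomorph_disk (K : Set ℂ)
    (hne : K.Nonempty) (hcpt : IsCompact K) (hconv : Convex ℝ K) :
    Nonempty (↥((((↑) : ℂ → OnePoint ℂ) '' K)ᶜ) ≃ₜ ↥(Metric.ball (0 : ℂ) 1)) :=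
  nonempty_homeomorph_compl_image_coe_ball hne hcpt hconv
end
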